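/- The Lennard-Jones potential φ(r) = r^{−12} − 2r^{−6} on (0,∞), with η = φ′ and η̂(r) = η(r) + 2η(2r), satisfies the structural assumptions with the explicit constants r̃₁ = (13/7)^{1/6}, r̃₂ = (13/4)^{1/6}, a₀ = (4097/4160)^{1/6}, and a₁ = (53261/29120)^{1/6}: namely, η′(r) > 0 on (0, r̃₁) and η′(r) < 0 on (r̃₁, ∞); η″(r) < 0 on (0, r̃₂) and η″(r) > 0 on (r̃₂, ∞); η̂(r) < 0 on (0, a₀) and η̂(r) > 0 on (a₀, ∞); η̂′(r) > 0 on (0, a₁) and η̂′(r) < 0 on (a₁, ∞); and moreover 0 < a₀ < r̃₁ < r̃₂ < 2a₀ and a₀ < a₁. -/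

import Mathlib

open Set

noncomputable section

/-- `η̂(r) = η(r) + 2 η(2r)`, the derivative of the energy density. -/
def etaHat (η : ℝ → ℝ) : ℝ → ℝ := fun r => η r + 2 * η (2*r)

/-- Structural assumptions on the atomistic potential (with `η = φ'`). -/
def Assump (η : ℝ → ℝ) (r1 r2 a0 a1 : ℝ) : Prop :=
  0 < a0 ∧ a0 < r1 ∧ r1 < r2 ∧ r2 < 2*a0 ∧ a0 < a1 ∧
  (∀ r ∈ Ioo (0:ℝ) r1, 0 < deriv η r) ∧ (∀ r ∈ Ioi r1, deriv η r < 0) ∧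
  (∀ r ∈ Ioo (0:ℝ) r2, deriv (deriv η) r < 0) ∧ (∀ r ∈ Ioi r2, 0 < deriv (deriv η) r) ∧
  (∀ r ∈ Ioo (0:ℝ) a0, etaHat η r < 0) ∧ (∀ r ∈ Ioi a0, 0 < etaHat η r) ∧
  (∀ r ∈ Ioo (0:ℝ) a1, 0 < deriv (etaHat η) r) ∧ (∀ r ∈ Ioi a1, deriv (etaHat η) r < 0)

theorem deriv_aux (f : ℝ → ℝ) (a b : ℝ) (m n : ℤ)
    (h : ∀ r : ℝ, 0 < r → f r = a * r ^ m + b * r ^ n) :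
    ∀ r : ℝ, 0 < r → deriv f r = (a * m) * r ^ (m - 1) + (b * n) * r ^ (n - 1) := by
  intro r hr
  have he : f =ᶠ[nhds r] fun r => a * r ^ m + b * r ^ n := by
    filter_upwards [Ioi_mem_nhds hr] with x hx using h x hx
  rw [he.deriv_eq]
  have h1 := (hasDerivAt_zpow m r (Or.inl hr.ne')).const_mul a
  have h2 := (hasDerivAt_zpow n r (Or.inl hr.ne')).const_mul b
  refine (h1.add h2).deriv.trans ?_
  ring

theorem sixth_aux (c : ℝ) (hc : 0 < c) (x : ℝ) (hx : x = c ^ ((1:ℝ)/6)) :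
    0 < x ∧ x ^ 6 = c := by
  subst hx
  refine ⟨Real.rpow_pos_of_pos hc _, ?_⟩
  rw [← Real.rpow_natCast, ← Real.rpow_mul hc.le]
  norm_num

theorem fac_aux (r : ℝ) (hr : 0 < r) (k l : ℤ) (hkl : l = k + 6) (a b : ℝ) :
    a * r ^ k + b * r ^ l = r ^ k * (a + b * r ^ 6) := by
  subst hkl
  rw [zpow_add₀ hr.ne']
  norm_cast
  ring

/-- The Lennard-Jones potential satisfies the structural assumptions with the explicit
constants `r̃₁ = (13/7)^{1/6}`, `r̃₂ = (13/4)^{1/6}`, `a₀ = (4097/4160)^{1/6}` and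
`a₁ = (53261/29120)^{1/6}`. -/
theorem lennardJones_structural_assumptions
    (φ : ℝ → ℝ) (hφ : φ = fun r => 1/r^12 - 2/r^6)
    (η : ℝ → ℝ) (hη : η = deriv φ)
    (r1 r2 a0 a1 : ℝ)
    (hr1 : r1 = ((13:ℝ)/7) ^ ((1:ℝ)/6))
    (hr2 : r2 = ((13:ℝ)/4) ^ ((1:ℝ)/6))
    (ha0 : a0 = ((4097:ℝ)/4160) ^ ((1:ℝ)/6))
    (ha1 : a1 = ((53261:ℝ)/29120) ^ ((1:ℝ)/6)) :
    Assump η r1 r2 a0 a1 := by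
  obtain ⟨p1, q1⟩ := sixth_aux _ (by norm_num) _ hr1
  obtain ⟨p2, q2⟩ := sixth_aux _ (by norm_num) _ hr2
  obtain ⟨p3, q3⟩ := sixth_aux _ (by norm_num) _ ha0
  obtain ⟨p4, q4⟩ := sixth_aux _ (by norm_num) _ ha1
  clear hr1 hr2 ha0 ha1
  have lt6 : ∀ x y : ℝ, 0 < y → x ^ 6 < y ^ 6 → x < y :=
    fun x y hy h => lt_of_pow_lt_pow_left₀ 6 hy.le h
  have mono6 : ∀ x y : ℝ, 0 < x → x < y → x ^ 6 < y ^ 6 :=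
    fun x y hx h => pow_lt_pow_left₀ h hx.le (by norm_num)
  have h0 : ∀ r : ℝ, 0 < r → φ r = 1 * r ^ (-12 : ℤ) + (-2) * r ^ (-6 : ℤ) := by
    intro r hr
    rw [hφ, zpow_neg, zpow_neg]
    norm_cast
    simp only [div_eq_mul_inv]
    push_cast
    ring
  have h1 := deriv_aux _ _ _ _ _ h0
  rw [← hη] at h1
  norm_num only at h1
  have h2 := deriv_aux _ _ _ _ _ h1
  norm_num only at h2
  have h3 := deriv_aux _ _ _ _ _ h2
  norm_num only at h3
  have h4 : ∀ r : ℝ, 0 < r → etaHat η r =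
      (-12 * (4097/4096)) * r ^ (-13 : ℤ) + (12 * (65/64)) * r ^ (-7 : ℤ) := by
    intro r hr
    rw [etaHat, h1 r hr, h1 (2*r) (by positivity), mul_zpow, mul_zpow]
    norm_num
    ring
  have h5 := deriv_aux _ _ _ _ _ h4
  norm_num only at h5
  refine ⟨p3, lt6 _ _ p1 ?_, lt6 _ _ p2 ?_, lt6 _ _ (by positivity) ?_, lt6 _ _ p4 ?_,
    ?_, ?_, ?_, ?_, ?_, ?_, ?_, ?_⟩
  · rw [q1, q3]; norm_num
  · rw [q1, q2]; norm_num
  · rw [mul_pow, q2, q3]; norm_num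
  · rw [q3, q4]; norm_num
  · rintro r ⟨hr, hlt⟩
    have := mono6 _ _ hr hlt
    rw [h2 r hr, fac_aux r hr _ _ (by norm_num)]
    exact mul_pos (by positivity) (by linarith)
  · intro r hlt
    have hr : 0 < r := p1.trans hlt
    have := mono6 _ _ p1 hlt
    rw [h2 r hr, fac_aux r hr _ _ (by norm_num)]
    exact mul_neg_of_pos_of_neg (by positivity) (by linarith)
  · rintro r ⟨hr, hlt⟩
    have := mono6 _ _ hr hlt
    rw [h3 r hr, fac_aux r hr _ _ (by norm_num)]
    exact mul_neg_of_pos_of_neg (by positivity) (by linarith)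
  · intro r hlt
    have hr : 0 < r := p2.trans hlt
    have := mono6 _ _ p2 hlt
    rw [h3 r hr, fac_aux r hr _ _ (by norm_num)]
    exact mul_pos (by positivity) (by linarith)
  · rintro r ⟨hr, hlt⟩
    have := mono6 _ _ hr hlt
    rw [h4 r hr, fac_aux r hr _ _ (by norm_num)]
    exact mul_neg_of_pos_of_neg (by positivity) (by linarith)
  · intro r hlt
    have hr : 0 < r := p3.trans hlt
    have := mono6 _ _ p3 hlt
    rw [h4 r hr, fac_aux r hr _ _ (by norm_num)]
    exact mul_pos (by positivity) (by linarith)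
  · rintro r ⟨hr, hlt⟩
    have := mono6 _ _ hr hlt
    rw [h5 r hr, fac_aux r hr _ _ (by norm_num)]
    exact mul_pos (by positivity) (by linarith)
  · intro r hlt
    have hr : 0 < r := p4.trans hlt
    have := mono6 _ _ p4 hlt
    rw [h5 r hr, fac_aux r hr _ _ (by norm_num)]
    exact mul_neg_of_pos_of_neg (by positivity) (by linarith)
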